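/- arXiv:2006.11260 — 2 statements merged into one kernel-verified Lean document; each statement's English description precedes it below -/
import Mathlib

section
/- (Sylvester–Franke theorem, eigenvalue form.) Let ρ be an m×m matrix with complex entries, let λ_1,…,λ_m be its eigenvalues repeated according to algebraic multiplicity, and let 1 ≤ l ≤ m. Then the eigenvalues of the l-th compound matrix of ρ, repeated according to algebraic multiplicity, are exactly the C(m,l) products λ_{υ_1} λ_{υ_2} ⋯ λ_{υ_l} over all multi-indices 1 ≤ υ_1 < … < υ_l ≤ m; equivalently, the characteristic polynomial of the l-th compound matrix equals ∏_{1 ≤ υ_1 < … < υ_l ≤ m} (X − λ_{υ_1}⋯λ_{υ_l}). -/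
open Matrix Polynomial

/-- Every endomorphism of a finite-dimensional space over an algebraically closed field is upper
triangular in a suitable basis. -/
theorem exists_basis_toMatrix_isUpperTriangular {K : Type*} [Field K] [IsAlgClosed K] (n : ℕ) :
    ∀ {V : Type*} [AddCommGroup V] [Module K V] [FiniteDimensional K V] (f : V →ₗ[K] V),
      Module.finrank K V = n →
        ∃ b : Module.Basis (Fin n) K V, (LinearMap.toMatrix b b f).IsUpperTriangular := by
  induction n with
  | zero =>
    intro V _ _ _ f hV
    exact ⟨Module.finBasisOfFinrankEq K V hV, fun i => i.elim0⟩
  | succ n ih =>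
    intro V _ _ _ f hV
    have : Nontrivial V := Module.nontrivial_of_finrank_pos (R := K) (by omega)
    obtain ⟨c, hc⟩ := Module.End.exists_eigenvalue f
    have hlt : LinearMap.range (f - algebraMap K (Module.End K V) c) < ⊤ := by
      rw [lt_top_iff_ne_top]
      intro h
      have h0 := LinearMap.ker_eq_bot_iff_range_eq_top.mpr h
      exact hc (Module.End.eigenspace_def.trans h0)
    obtain ⟨φ, hφ, hle⟩ := Submodule.exists_le_ker_of_lt_top _ hlt
    have hker : ∀ x, φ (f x) = c * φ x := fun x => by
      have h : φ ((f - algebraMap K (Module.End K V) c) x) = 0 := hle ⟨x, rfl⟩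
      simpa [sub_eq_zero] using h
    have hinv : ∀ x ∈ LinearMap.ker φ, f x ∈ LinearMap.ker φ := fun x hx => by
      rw [LinearMap.mem_ker] at hx ⊢
      rw [hker, hx, mul_zero]
    have hrank : Module.finrank K (LinearMap.ker φ) = n := by
      have := Module.Dual.finrank_ker_add_one_of_ne_zero hφ
      omega
    obtain ⟨y, hy⟩ : ∃ y, φ y ≠ 0 := by
      by_contra! h
      exact hφ (LinearMap.ext h)
    obtain ⟨bN, hbN⟩ := ih (f.restrict hinv) hrank
    let b := Module.Basis.mkFinSnoc bN y
      (fun a x hx h => by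
        have h' := congrArg φ h
        rw [LinearMap.mem_ker] at hx
        simpa [hx, hy] using h')
      (fun z => ⟨-(φ z / φ y), by simp [hy]⟩)
    have hb : ∀ i, b (Fin.castSucc i) = bN i := fun i => by simp [b]
    have hrepr : ∀ x : LinearMap.ker φ,
        b.repr x = Finsupp.lmapDomain K K Fin.castSucc (bN.repr x) := by
      have h : b.repr.toLinearMap ∘ₗ (LinearMap.ker φ).subtype =
          Finsupp.lmapDomain K K Fin.castSucc ∘ₗ bN.repr.toLinearMap := by
        refine bN.ext fun i => ?_
        simp [← hb]
      exact fun x => LinearMap.congr_fun h x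
    refine ⟨b, fun i j hij => ?_⟩
    change j < i at hij
    rw [LinearMap.toMatrix_apply]
    induction j using Fin.lastCases with
    | last => exact absurd hij (Fin.le_last i).not_gt
    | cast j =>
      have h := hrepr (f.restrict hinv (bN j))
      rw [LinearMap.coe_restrict_apply, ← hb] at h
      rw [h]
      induction i using Fin.lastCases with
      | last =>
        rw [Finsupp.lmapDomain_apply, Finsupp.mapDomain_of_notMem_range]
        simp
      | cast i =>
        rw [Finsupp.lmapDomain_apply,
          Finsupp.mapDomain_apply (Fin.castSucc_injective n)]
        have := hbN (i := i) (j := j) (by simpa using hij)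
        rwa [LinearMap.toMatrix_apply] at this

/-- The characteristic polynomial of a matrix that is block triangular with blocks of size one. -/
theorem charpoly_of_blockTriangular_injective {n α R : Type*} [Fintype n] [DecidableEq n]
    [LinearOrder α] [CommRing R] {M : Matrix n n R} {b : n → α} (hM : M.BlockTriangular b)
    (hb : Function.Injective b) : M.charpoly = ∏ i, (X - C (M i i)) := by
  let : LinearOrder n := LinearOrder.lift' b hb
  exact charpoly_of_isUpperTriangular M fun i j h => hM h

/-- The `l`-th compound matrix. -/
def compoundMatrix {R ι : Type*} [CommRing R] [LinearOrder ι] (l : ℕ) (M : Matrix ι ι R) :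
    Matrix {s : Finset ι // s.card = l} {s : Finset ι // s.card = l} R :=
  Matrix.of fun μ ν =>
    (M.submatrix (μ.1.orderEmbOfFin μ.2) (ν.1.orderEmbOfFin ν.2)).det

/-- The two descriptions of the type of `l`-element subsets. -/
def powersetCardEquivSubtype (ι : Type*) (l : ℕ) :
    Set.powersetCard ι l ≃ {s : Finset ι // s.card = l} where
  toFun s := ⟨s.1, s.2⟩
  invFun s := ⟨s.1, s.2⟩

/-- The compound matrix represents the induced endomorphism of the exterior power. -/
theorem toMatrix_exteriorPower_map {R V ι : Type*} [CommRing R] [AddCommGroup V] [Module R V]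
    [LinearOrder ι] [Fintype ι] (l : ℕ) (b : Module.Basis ι R V) (f : V →ₗ[R] V) :
    Matrix.reindex (powersetCardEquivSubtype ι l) (powersetCardEquivSubtype ι l)
      (LinearMap.toMatrix (b.exteriorPower l) (b.exteriorPower l) (exteriorPower.map l f)) =
      compoundMatrix l (LinearMap.toMatrix b b f) := by
  ext μ ν
  rw [Matrix.reindex_apply, Matrix.submatrix_apply, LinearMap.toMatrix_apply,
    exteriorPower.basis_apply, exteriorPower.basis_repr_apply,
    exteriorPower.map_apply_ιMulti_family, exteriorPower.ιMulti_family,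
    exteriorPower.ιMultiDual_apply_ιMulti, ← Matrix.det_transpose]
  congr 1
  ext i j
  simp [LinearMap.toMatrix_apply, Set.powersetCard.ofFinEmbEquiv_symm_apply,
    powersetCardEquivSubtype]

theorem charpoly_compoundMatrix_toMatrix {R V ι : Type*} [CommRing R] [AddCommGroup V]
    [Module R V] [LinearOrder ι] [Fintype ι] (l : ℕ) (b b' : Module.Basis ι R V)
    (f : V →ₗ[R] V) :
    (compoundMatrix l (LinearMap.toMatrix b b f)).charpoly =
      (compoundMatrix l (LinearMap.toMatrix b' b' f)).charpoly := by
  have : Module.Free R V := Module.Free.of_basis b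
  have : Module.Finite R V := Module.Finite.of_basis b
  have h (b : Module.Basis ι R V) : (compoundMatrix l (LinearMap.toMatrix b b f)).charpoly =
      (exteriorPower.map l f).charpoly := by
    rw [← LinearMap.charpoly_toMatrix (exteriorPower.map l f) (b.exteriorPower l),
      ← toMatrix_exteriorPower_map, Matrix.charpoly_reindex]
  rw [h b, h b']

theorem sum_orderEmbOfFin {ι A : Type*} [LinearOrder ι] [AddCommMonoid A] {l : ℕ}
    (s : Finset ι) (hs : s.card = l) (g : ι → A) :
    ∑ i, g (s.orderEmbOfFin hs i) = ∑ i ∈ s, g i := by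
  conv_rhs => rw [← Finset.map_orderEmbOfFin_univ s hs, Finset.sum_map]
  rfl

/-- The compound of an upper triangular matrix is triangular for the binary ordering of
subsets. -/
theorem blockTriangular_compoundMatrix {R : Type*} [CommRing R] {m : ℕ} (l : ℕ)
    {M : Matrix (Fin m) (Fin m) R} (hM : M.IsUpperTriangular) :
    (compoundMatrix l M).BlockTriangular fun s => ∑ i ∈ s.1, 2 ^ (i : ℕ) := by
  intro μ ν h
  by_contra hne
  refine h.not_ge ?_
  rw [compoundMatrix, Matrix.of_apply, Matrix.det_apply] at hne
  obtain ⟨σ, -, hσ⟩ := Finset.exists_ne_zero_of_sum_ne_zero hne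
  have hle : ∀ i, μ.1.orderEmbOfFin μ.2 (σ i) ≤ ν.1.orderEmbOfFin ν.2 i := fun i => by
    by_contra! hlt
    refine hσ ?_
    rw [Finset.prod_eq_zero (Finset.mem_univ i) (hM hlt), smul_zero]
  dsimp only
  rw [← sum_orderEmbOfFin μ.1 μ.2, ← sum_orderEmbOfFin ν.1 ν.2, ← Equiv.sum_comp σ]
  exact Finset.sum_le_sum fun i _ => Nat.pow_le_pow_right two_pos (hle i)

theorem sum_two_pow_val_injective (m : ℕ) :
    Function.Injective fun s : Finset (Fin m) => ∑ i ∈ s, 2 ^ (i : ℕ) := by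
  intro s t h
  refine Finset.map_injective Fin.valEmbedding (Finset.geomSum_injective le_rfl ?_)
  simpa using h

theorem compoundMatrix_apply_self {R : Type*} [CommRing R] {m l : ℕ}
    {M : Matrix (Fin m) (Fin m) R} (hM : M.IsUpperTriangular)
    (s : {s : Finset (Fin m) // s.card = l}) :
    compoundMatrix l M s s = ∏ i ∈ s.1, M i i := by
  have h : (M.submatrix (s.1.orderEmbOfFin s.2) (s.1.orderEmbOfFin s.2)).IsUpperTriangular :=
    fun i j h => hM ((s.1.orderEmbOfFin s.2).strictMono h)
  rw [compoundMatrix, Matrix.of_apply, Matrix.det_of_isUpperTriangular h]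
  conv_rhs => rw [← Finset.map_orderEmbOfFin_univ s.1 s.2, Finset.prod_map]
  rfl

/-- A product over `l`-element subsets only depends on the multiset of values. -/
theorem prod_subtype_card_eq_multiset {ι A B : Type*} [Fintype ι] [DecidableEq ι]
    [CommMonoid A] [CommMonoid B] (l : ℕ) (d : ι → A) (F : A → B) :
    ∏ s : {s : Finset ι // s.card = l}, F (∏ i ∈ s.1, d i) =
      (((Finset.univ.val.map d).powersetCard l).map fun t => F t.prod).prod := by
  rw [Multiset.powersetCard_map, ← Finset.map_val_val_powersetCard, Multiset.map_map,
    Multiset.map_map]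
  rw [← Finset.prod_subtype (Finset.univ.powersetCard l) (p := fun s => s.card = l)
    (by simp) (fun s => F (∏ i ∈ s, d i))]
  rfl

/-- **Sylvester–Franke theorem, eigenvalue form.** Let `ρ` be an `m × m` complex
matrix whose eigenvalues, repeated with algebraic multiplicity, are `lam 0, …,
lam (m-1)` (i.e. its characteristic polynomial is `∏ i, (X - C (lam i))`), and let
`1 ≤ l ≤ m`.  Then the characteristic polynomial of the `l`-th compound matrix of
`ρ` (indexed by the `l`-element subsets of `Fin m`, with the same ordering for rows
and columns) is `∏_{υ} (X - C (λ_{υ_1} ⋯ λ_{υ_l}))`, the product being over all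
strictly increasing multi-indices `υ`; that is, the eigenvalues of the compound
matrix, with algebraic multiplicity, are the `C(m,l)` products `λ_{υ_1} ⋯ λ_{υ_l}`. -/
theorem stmt_10 (m l : ℕ) (hl : 1 ≤ l) (hlm : l ≤ m)
    (ρ : Matrix (Fin m) (Fin m) ℂ) (lam : Fin m → ℂ)
    (hcp : ρ.charpoly = ∏ i : Fin m, (X - C (lam i))) :
    (Matrix.of fun (μ ν : {s : Finset (Fin m) // s.card = l}) =>
      (ρ.submatrix (μ.1.orderEmbOfFin μ.2) (ν.1.orderEmbOfFin ν.2)).det).charpoly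
      = ∏ s : {s : Finset (Fin m) // s.card = l}, (X - C (∏ i ∈ s.1, lam i)) := by
  change (compoundMatrix l ρ).charpoly = _
  obtain ⟨b, hb⟩ := exists_basis_toMatrix_isUpperTriangular (K := ℂ) m (Matrix.toLin' ρ) (by simp)
  set T := LinearMap.toMatrix b b (Matrix.toLin' ρ) with hT
  have hρ : LinearMap.toMatrix (Pi.basisFun ℂ (Fin m)) (Pi.basisFun ℂ (Fin m))
      (Matrix.toLin' ρ) = ρ := by
    rw [LinearMap.toMatrix_eq_toMatrix', LinearMap.toMatrix'_toLin']
  have hdiag : Finset.univ.val.map (fun i => T i i) = Finset.univ.val.map lam := by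
    have h : ∏ i, (X - C (T i i)) = ∏ i, (X - C (lam i)) := by
      rw [← hcp, ← charpoly_of_isUpperTriangular T hb, hT, LinearMap.charpoly_toMatrix]
      conv_rhs => rw [← hρ, LinearMap.charpoly_toMatrix]
    have h' := congrArg Polynomial.roots h
    have hroots (d : Fin m → ℂ) : (∏ i, (X - C (d i))).roots = Finset.univ.val.map d := by
      rw [← Polynomial.roots_multiset_prod_X_sub_C (Finset.univ.val.map d), Multiset.map_map]
      rfl
    rwa [hroots, hroots] at h'
  have hcomp := charpoly_compoundMatrix_toMatrix l (Pi.basisFun ℂ (Fin m)) b (Matrix.toLin' ρ)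
  rw [hρ, ← hT] at hcomp
  rw [hcomp, charpoly_of_blockTriangular_injective (blockTriangular_compoundMatrix l hb)
    fun s t h => Subtype.ext (sum_two_pow_val_injective m h)]
  simp_rw [compoundMatrix_apply_self hb]
  rw [prod_subtype_card_eq_multiset l (fun i => T i i) fun a => X - C a,
    prod_subtype_card_eq_multiset l lam fun a => X - C a, hdiag]
end

section
/- Let k, m be positive integers and let q be an integer (positive or negative) satisfying log|q| > k²m + km·log(2 d_m) + k·log(km+1) + k, where d_m = lcm(1,…,m). Then the km+1 real numbers 1, Li_1(1/q),…,Li_k(1/q), Li_1(1/(2q)),…,Li_k(1/(2q)), …, Li_1(1/(mq)),…,Li_k(1/(mq)) are linearly independent over ℚ. -/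
/-- The `j`-th polylogarithm `Li_j(x) = ∑_{t ≥ 1} x^t / t^j` of a real number. -/
noncomputable def liR (j : ℕ) (x : ℝ) : ℝ := ∑' t : ℕ, x ^ (t + 1) / ((t : ℝ) + 1) ^ j

/-- `d N = lcm (1, 2, …, N)`, the least common multiple of the first `N` integers. -/
def dLcm (N : ℕ) : ℕ := (Finset.Icc 1 N).lcm id

section PolynomialFunctionals

open Polynomial

/-- The linear functional `∑ aᵤ Xᵘ ↦ ∑ g u * aᵤ` on polynomials. -/
noncomputable def weightedSum (g : ℕ → ℝ) : ℝ[X] →ₗ[ℝ] ℝ :=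
  lsum fun u => g u • LinearMap.id

/-- The linear operator `∑ aᵤ Xᵘ ↦ ∑ c u * aᵤ Xᵘ` on polynomials. -/
noncomputable def diagOp (c : ℕ → ℝ) : ℝ[X] →ₗ[ℝ] ℝ[X] :=
  lsum fun u => c u • monomial u

theorem weightedSum_eq_sum (g : ℕ → ℝ) (F : ℝ[X]) :
    weightedSum g F = ∑ u ∈ F.support, g u * F.coeff u := by
  simp [weightedSum, lsum_apply, Polynomial.sum_def]

@[simp]
theorem weightedSum_monomial (g : ℕ → ℝ) (u : ℕ) (a : ℝ) :
    weightedSum g (monomial u a) = g u * a := by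
  simp [weightedSum, lsum_apply, sum_monomial_index]

@[simp]
theorem diagOp_monomial (c : ℕ → ℝ) (u : ℕ) (a : ℝ) :
    diagOp c (monomial u a) = monomial u (c u * a) := by
  simp [diagOp, lsum_apply, sum_monomial_index, smul_monomial]

theorem coeff_diagOp (c : ℕ → ℝ) (F : ℝ[X]) (u : ℕ) :
    (diagOp c F).coeff u = c u * F.coeff u := by
  induction F using Polynomial.induction_on' with
  | add p q hp hq => simp [hp, hq, mul_add]
  | monomial n a =>
    rw [diagOp_monomial, coeff_monomial, coeff_monomial]
    split_ifs with h <;> simp [h]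

theorem natDegree_diagOp_le (c : ℕ → ℝ) (F : ℝ[X]) : (diagOp c F).natDegree ≤ F.natDegree := by
  rw [natDegree_le_iff_coeff_eq_zero]
  intro N hN
  rw [coeff_diagOp, coeff_eq_zero_of_natDegree_lt hN, mul_zero]

theorem eq_zero_of_diagOp_eq_zero {c : ℕ → ℝ} (hc : ∀ u, c u ≠ 0) {F : ℝ[X]}
    (h : diagOp c F = 0) : F = 0 := by
  ext u
  have := congrArg (fun p => coeff p u) h
  simpa [coeff_diagOp, hc u] using this

theorem weightedSum_diagOp (g c : ℕ → ℝ) (F : ℝ[X]) :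
    weightedSum g (diagOp c F) = weightedSum (fun u => g u * c u) F := by
  induction F using Polynomial.induction_on' with
  | add p q hp hq => simp [hp, hq]
  | monomial n a => simp [mul_assoc]

theorem weightedSum_X_pow_mul (g : ℕ → ℝ) (j : ℕ) (F : ℝ[X]) :
    weightedSum g (X ^ j * F) = weightedSum (fun u => g (u + j)) F := by
  induction F using Polynomial.induction_on' with
  | add p q hp hq => simp [hp, hq, mul_add]
  | monomial n a => rw [X_pow_mul_monomial]; simp

theorem weightedSum_const_mul (r : ℝ) (g : ℕ → ℝ) (F : ℝ[X]) :
    weightedSum (fun u => r * g u) F = r * weightedSum g F := by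
  simp [weightedSum_eq_sum, Finset.mul_sum, mul_assoc]

theorem weightedSum_finset_sum {ι : Type*} (s : Finset ι) (g : ι → ℕ → ℝ) (F : ℝ[X]) :
    weightedSum (fun u => ∑ i ∈ s, g i u) F = ∑ i ∈ s, weightedSum (g i) F := by
  simp only [weightedSum_eq_sum, Finset.sum_mul]
  exact Finset.sum_comm

theorem weightedSum_pow (e : ℝ) (F : ℝ[X]) : weightedSum (fun u => e ^ u) F = F.eval e := by
  induction F using Polynomial.induction_on' with
  | add p q hp hq => simp [hp, hq]
  | monomial n a => simp [mul_comm]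

theorem weightedSum_natCast_mul (g : ℕ → ℝ) (F : ℝ[X]) :
    weightedSum (fun u => u * g u) F = weightedSum g (X * derivative F) := by
  induction F using Polynomial.induction_on' with
  | add p q hp hq => simp [hp, hq, mul_add]
  | monomial n a =>
    rw [derivative_monomial, X_mul_monomial]
    rcases n with _ | n
    · rw [weightedSum_monomial]
      simp
    · simp; ring

theorem weightedSum_natCast_pow_mul_pow_eq_zero {e : ℝ} (r : ℕ) {K : ℕ} (hr : r < K) {F : ℝ[X]}
    (hF : (X - C e) ^ K ∣ F) : weightedSum (fun u => (u : ℝ) ^ r * e ^ u) F = 0 := by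
  induction r generalizing K F with
  | zero =>
    have h : X - C e ∣ F := (dvd_pow_self _ hr.ne').trans hF
    simpa [weightedSum_pow] using dvd_iff_isRoot.mp h
  | succ r ih =>
    have h := ih (K := K - 1) (by omega)
      ((pow_sub_one_dvd_derivative_of_pow_dvd hF).mul_left X)
    rw [← weightedSum_natCast_mul] at h
    simpa only [pow_succ', mul_assoc] using h

/-- A polynomial vanishing to order `K` at `e` is annihilated by `∑ aᵤ G(u) eᵘ` for every
polynomial `G` of degree less than `K`. -/
theorem weightedSum_eval_mul_pow_eq_zero {e : ℝ} {K : ℕ} {F G : ℝ[X]}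
    (hF : (X - C e) ^ K ∣ F) (hG : G.natDegree < K) :
    weightedSum (fun u => G.eval (u : ℝ) * e ^ u) F = 0 := by
  simp only [eval_eq_sum_range, Finset.sum_mul]
  rw [weightedSum_finset_sum]
  refine Finset.sum_eq_zero fun r hr => ?_
  simp only [mul_assoc]
  rw [weightedSum_const_mul, weightedSum_natCast_pow_mul_pow_eq_zero r _ hF, mul_zero]
  have := Finset.mem_range.mp hr
  omega

theorem weightedSum_descPochhammer (e : ℝ) (r : ℕ) (F : ℝ[X]) :
    weightedSum (fun u => (descPochhammer ℝ r).eval (u : ℝ) * e ^ u) F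
      = e ^ r * (derivative^[r] F).eval e := by
  induction F using Polynomial.induction_on' with
  | add p q hp hq => simp [hp, hq, mul_add, iterate_map_add]
  | monomial n a =>
    rw [weightedSum_monomial, descPochhammer_eval_eq_descFactorial, ← C_mul_X_pow_eq_monomial,
      iterate_derivative_C_mul, iterate_derivative_X_pow_eq_natCast_mul]
    rcases lt_or_ge n r with h | h
    · simp [Nat.descFactorial_of_lt h]
    · obtain ⟨t, rfl⟩ := Nat.exists_eq_add_of_le h
      simp [pow_add]; ring

theorem X_sub_C_pow_dvd_of_weightedSum_eq_zero {e : ℝ} (he : e ≠ 0) {K : ℕ} {F : ℝ[X]}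
    (h : ∀ G : ℝ[X], G.natDegree < K → weightedSum (fun u => G.eval (u : ℝ) * e ^ u) F = 0) :
    (X - C e) ^ K ∣ F := by
  rcases eq_or_ne F 0 with rfl | hF
  · exact dvd_zero _
  rcases K with _ | K
  · simp
  rw [← le_rootMultiplicity_iff hF, Nat.succ_le_iff,
    lt_rootMultiplicity_iff_isRoot_iterate_derivative hF]
  intro r hr
  have := h (descPochhammer ℝ r) (by rw [descPochhammer_natDegree]; omega)
  rw [weightedSum_descPochhammer] at this
  simpa [he] using this

/-- The functional `Xʲ ↦ e^(j+1) / (j+1)^s`, whose generating series in `1/z` is `Li_s(e/z)`. -/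
noncomputable def polylogFunctional (e : ℝ) (s : ℕ) : ℝ[X] →ₗ[ℝ] ℝ :=
  weightedSum fun u => e ^ (u + 1) / ((u : ℝ) + 1) ^ s

theorem polylogFunctional_X_pow_mul (e : ℝ) (s j : ℕ) (F : ℝ[X]) :
    polylogFunctional e s (X ^ j * F)
      = e ^ (j + 1) * weightedSum (fun u => e ^ u / ((u : ℝ) + j + 1) ^ s) F := by
  rw [polylogFunctional, weightedSum_X_pow_mul, ← weightedSum_const_mul]
  congr 2
  ext u
  push_cast
  rw [show u + j + 1 = (j + 1) + u by ring, pow_add, mul_div_assoc]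

/-- The orthogonality relations of the Padé approximants. -/
theorem polylogFunctional_X_pow_mul_diagOp_eq_zero {e : ℝ} {n k j s : ℕ} (hj : j < n) (hs : 1 ≤ s)
    (hsk : s ≤ k) {F : ℝ[X]} (hF : (X - C e) ^ (k * n) ∣ F) :
    polylogFunctional e s (X ^ j * diagOp (fun u => ((u + n).choose n : ℝ) ^ k) F) = 0 := by
  rw [polylogFunctional_X_pow_mul, weightedSum_diagOp]
  set G : ℝ[X] := (X + C ((j : ℝ) + 1)) ^ (k - s) *
    ∏ v ∈ (Finset.range n).erase j, (X + C ((v : ℝ) + 1)) ^ k with hGdef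
  have hdeg : G.natDegree < k * n := by
    have h1 : G.natDegree ≤ (k - s) + ∑ v ∈ (Finset.range n).erase j, k := by
      refine natDegree_mul_le.trans (add_le_add ?_ ((natDegree_prod_le _ _).trans
        (Finset.sum_le_sum fun v _ => ?_)))
      · exact natDegree_pow_le.trans (by rw [natDegree_X_add_C, mul_one])
      · exact natDegree_pow_le.trans (by rw [natDegree_X_add_C, mul_one])
    rw [Finset.sum_const, Finset.card_erase_of_mem (Finset.mem_range.mpr hj),
      Finset.card_range, smul_eq_mul] at h1
    obtain ⟨n, rfl⟩ : ∃ t, n = t + 1 := ⟨n - 1, by omega⟩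
    rw [Nat.add_sub_cancel] at h1
    have : k * (n + 1) = n * k + k := by ring
    omega
  have hprod (u : ℕ) : ((u + n).choose n : ℝ) ^ k * ((n.factorial : ℝ)) ^ k
      = G.eval (u : ℝ) * ((u : ℝ) + j + 1) ^ s := by
    have h1 : ((u + n).choose n : ℝ) * (n.factorial : ℝ) =
        ∏ v ∈ Finset.range n, ((u : ℝ) + (v + 1)) := by
      have := Nat.ascFactorial_eq_factorial_mul_choose u n
      rw [mul_comm, ← Nat.cast_mul, ← this, Nat.ascFactorial_eq_prod_range]
      push_cast
      exact Finset.prod_congr rfl fun v _ => by ring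
    rw [← mul_pow, h1, ← Finset.mul_prod_erase _ _ (Finset.mem_range.mpr hj), hGdef, eval_mul,
      eval_pow, eval_prod]
    simp only [eval_pow, eval_add, eval_X, eval_C]
    rw [mul_pow, Finset.prod_pow, mul_right_comm, ← add_assoc, ← pow_add, Nat.sub_add_cancel hsk]
  have hfun : (fun u : ℕ => e ^ u / ((u : ℝ) + j + 1) ^ s * ((u + n).choose n : ℝ) ^ k)
      = fun u : ℕ => (((n.factorial : ℝ)) ^ k)⁻¹ * (G.eval (u : ℝ) * e ^ u) := by
    ext u
    have h2 : ((u : ℝ) + j + 1) ^ s ≠ 0 := by positivity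
    have h3 : ((n.factorial : ℝ)) ^ k ≠ 0 := by positivity
    have := hprod u
    field_simp
    linear_combination this * e ^ u
  rw [hfun, weightedSum_const_mul, weightedSum_eval_mul_pow_eq_zero hF hdeg, mul_zero, mul_zero]

/-- Normality of the polylogarithm system: a polynomial of degree less than `m * (k * (n + 1))`
satisfying the orthogonality relations of order `n + 1` vanishes. -/
theorem eq_zero_of_polylogFunctional_eq_zero {m k n : ℕ} {e : Fin m → ℝ}
    (he : Function.Injective e) (he0 : ∀ i, e i ≠ 0) {F : ℝ[X]}
    (hF : F.degree < (m * (k * (n + 1)) : ℕ))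
    (h : ∀ i, ∀ j ≤ n, ∀ s, 1 ≤ s → s ≤ k → polylogFunctional (e i) s (X ^ j * F) = 0) :
    F = 0 := by
  set g : ℕ → ℝ[X] := fun j => X - C (-((j : ℝ) + 1)) with hg
  have hgm (j : ℕ) : (g j).Monic := monic_X_sub_C _
  have hgd (j : ℕ) : (g j).natDegree = 1 := natDegree_X_sub_C _
  have hge (j u : ℕ) : (g j).eval (u : ℝ) = (u : ℝ) + j + 1 := by simp [hg]; ring
  have hgpos (j u : ℕ) : 0 < (g j).eval (u : ℝ) := by rw [hge]; positivity
  have hcop : Set.Pairwise (Finset.range (n + 1) : Set ℕ) fun i j => IsCoprime (g i) (g j) := by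
    intro i _ j _ hij
    refine isCoprime_X_sub_C_of_isUnit_sub (IsUnit.mk0 _ ?_)
    intro h0
    exact hij (by exact_mod_cast (by linarith : (i : ℝ) = j))
  set W : ℝ[X] := ∏ j ∈ Finset.range (n + 1), g j ^ k with hW
  have hWm : W.Monic := monic_prod_of_monic _ _ fun j _ => (hgm j).pow k
  have hWd : W.natDegree = k * (n + 1) := by
    rw [hW, natDegree_prod_of_monic _ _ fun j _ => (hgm j).pow k]
    simp [natDegree_pow, hgd, mul_comm]
  have hWe (u : ℕ) : 0 < W.eval (u : ℝ) := by
    rw [hW, eval_prod]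
    exact Finset.prod_pos fun j _ => by rw [eval_pow]; exact pow_pos (hgpos j u) k
  set F' := diagOp (fun u => (W.eval (u : ℝ))⁻¹) F with hF'
  suffices hz : F' = 0 from eq_zero_of_diagOp_eq_zero (fun u => inv_ne_zero (hWe u).ne') hz
  have hdvd (i : Fin m) : (X - C (e i)) ^ (k * (n + 1)) ∣ F' := by
    refine X_sub_C_pow_dvd_of_weightedSum_eq_zero (he0 i) fun G hG => ?_
    obtain ⟨q, r, hr, hqr⟩ := eq_quo_mul_prod_pow_add_sum_rem_mul_prod_pow G
      (fun j _ => hgm j) hcop (fun _ => k)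
    have hrem : (∑ j ∈ Finset.range (n + 1), ∑ t : Fin k,
        r j t * g j ^ t.1 * ∏ l ∈ (Finset.range (n + 1)).erase j, g l ^ k).degree < W.degree := by
      rw [degree_eq_natDegree hWm.ne_zero, hWd]
      refine (degree_sum_le _ _).trans_lt ((Finset.sup_lt_iff (WithBot.bot_lt_coe _)).mpr
        fun j hj => (degree_sum_le _ _).trans_lt ((Finset.sup_lt_iff (WithBot.bot_lt_coe _)).mpr
        fun t _ => ?_))
      have h1 := hr j hj t
      rw [degree_X_sub_C, Nat.WithBot.lt_one_iff_le_zero] at h1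
      have h2 : (r j t * g j ^ t.1 *
          ∏ l ∈ (Finset.range (n + 1)).erase j, g l ^ k).natDegree ≤ (0 + t.1) + k * n := by
        refine natDegree_mul_le.trans (add_le_add (natDegree_mul_le.trans (add_le_add ?_ ?_)) ?_)
        · exact natDegree_le_of_degree_le h1
        · exact natDegree_pow_le.trans (by rw [hgd, mul_one])
        · rw [natDegree_prod_of_monic _ _ fun l _ => (hgm l).pow k]
          simp [natDegree_pow, hgd, Finset.card_erase_of_mem hj, mul_comm]
      refine degree_le_natDegree.trans_lt (Nat.cast_lt.mpr (h2.trans_lt ?_))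
      have := t.2
      rw [mul_add, mul_one]
      omega
    have hq : q = 0 := by
      by_contra hq0
      have h1 : (q * W).degree < W.degree := by
        rw [eq_sub_of_add_eq hqr.symm]
        refine (degree_sub_le _ _).trans_lt (max_lt ?_ hrem)
        rw [degree_eq_natDegree hWm.ne_zero, hWd]
        exact degree_le_natDegree.trans_lt (Nat.cast_lt.mpr hG)
      rw [degree_mul, degree_eq_natDegree hq0, degree_eq_natDegree hWm.ne_zero] at h1
      have h3 : q.natDegree + W.natDegree < W.natDegree := by exact_mod_cast h1
      omega
    have hfun : (fun u : ℕ => G.eval (u : ℝ) * e i ^ u * (W.eval (u : ℝ))⁻¹) =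
        fun u : ℕ => ∑ j ∈ Finset.range (n + 1), ∑ t : Fin k,
          (r j t).coeff 0 * (e i ^ u / ((u : ℝ) + j + 1) ^ (k - t.1)) := by
      ext u
      rw [hqr, hq, zero_mul, zero_add, eval_finsetSum, Finset.sum_mul, Finset.sum_mul]
      refine Finset.sum_congr rfl fun j hj => ?_
      rw [eval_finsetSum, Finset.sum_mul, Finset.sum_mul]
      refine Finset.sum_congr rfl fun t _ => ?_
      have h1 := hr j hj t
      rw [degree_X_sub_C, Nat.WithBot.lt_one_iff_le_zero] at h1
      rw [eq_C_of_degree_le_zero h1, hW, ← Finset.mul_prod_erase _ _ hj, eval_mul, eval_mul,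
        eval_mul, eval_C, coeff_C_zero, eval_pow, eval_pow]
      have h3 : 0 < (∏ l ∈ (Finset.range (n + 1)).erase j, g l ^ k).eval (u : ℝ) := by
        rw [eval_prod]
        exact Finset.prod_pos fun l _ => by rw [eval_pow]; exact pow_pos (hgpos l u) k
      have h4 := (hgpos j u).ne'
      have h5 : (g j).eval (u : ℝ) ^ k
          = (g j).eval (u : ℝ) ^ (k - t.1) * (g j).eval (u : ℝ) ^ t.1 := by
        rw [← pow_add, Nat.sub_add_cancel t.2.le]
      rw [← hge, h5]
      have h6 := h3.ne'
      field_simp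
    rw [hF', weightedSum_diagOp, hfun, weightedSum_finset_sum]
    refine Finset.sum_eq_zero fun j hj => ?_
    rw [weightedSum_finset_sum]
    refine Finset.sum_eq_zero fun t _ => ?_
    have h1 := h i j (Nat.lt_succ_iff.mp (Finset.mem_range.mp hj)) (k - t.1)
      (by have := t.2; omega) (Nat.sub_le _ _)
    rw [polylogFunctional_X_pow_mul] at h1
    rw [weightedSum_const_mul,
      (mul_eq_zero.mp h1).resolve_left (pow_ne_zero _ (he0 i)), mul_zero]
  have hprod : ∏ i, (X - C (e i)) ^ (k * (n + 1)) ∣ F' :=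
    Finset.prod_dvd_of_coprime
      (fun i _ j _ hij => (pairwise_coprime_X_sub_C he hij).pow) fun i _ => hdvd i
  by_contra hne
  have hd := degree_le_of_dvd hprod hne
  have hm : (∏ i, (X - C (e i)) ^ (k * (n + 1))).Monic :=
    monic_prod_of_monic _ _ fun i _ => (monic_X_sub_C _).pow _
  rw [degree_eq_natDegree hm.ne_zero,
    natDegree_prod_of_monic _ _ fun i _ => (monic_X_sub_C _).pow _] at hd
  simp only [natDegree_pow, natDegree_X_sub_C, mul_one, Finset.sum_const, Finset.card_univ,
    Fintype.card_fin, smul_eq_mul] at hd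
  rw [degree_eq_natDegree hne, Nat.cast_le] at hd
  have hF0 : F ≠ 0 := by
    rintro rfl
    exact hne (map_zero _)
  rw [degree_eq_natDegree hF0, Nat.cast_lt] at hF
  exact absurd (hd.trans (natDegree_diagOp_le _ F)) (by omega)

theorem X_sub_C_mul_divByMonic (P : ℝ[X]) (z : ℝ) :
    (X - C z) * (P /ₘ (X - C z)) = P - C (P.eval z) := by
  rw [← modByMonic_X_sub_C_eq_C_eval, eq_sub_iff_add_eq, add_comm, modByMonic_add_div]

/-- The value `P(z)` together with the values at `z` of the polynomials
`∑ (P(z) - P(t)) / (z - t)` obtained by applying the polylogarithm functionals in `t`. -/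
noncomputable def padeVector {m : ℕ} (k : ℕ) (e : Fin m → ℝ) (z : ℝ) :
    ℝ[X] →ₗ[ℝ] (Option (Fin m × Fin k) → ℝ) where
  toFun P x := x.elim (P.eval z)
    fun y => polylogFunctional (e y.1) ((y.2 : ℕ) + 1) (P /ₘ (X - C z))
  map_add' P Q := by
    have h : (P + Q) /ₘ (X - C z) = P /ₘ (X - C z) + Q /ₘ (X - C z) := by
      apply mul_left_cancel₀ (X_sub_C_ne_zero z)
      rw [mul_add, X_sub_C_mul_divByMonic, X_sub_C_mul_divByMonic, X_sub_C_mul_divByMonic,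
        eval_add, C_add]
      ring
    funext x
    cases x <;> simp [h]
  map_smul' r P := by
    have h : (r • P) /ₘ (X - C z) = r • (P /ₘ (X - C z)) := by
      apply mul_left_cancel₀ (X_sub_C_ne_zero z)
      rw [mul_smul_comm, X_sub_C_mul_divByMonic, X_sub_C_mul_divByMonic, eval_smul,
        smul_eq_C_mul, smul_eq_C_mul, smul_eq_mul, C_mul]
      ring
    funext x
    cases x <;> simp [h]

/-- The common denominator of simultaneous Padé approximants of order `n` for the polylogarithms
`Li_s(eᵢ / z)`, depending linearly on an auxiliary polynomial. -/
noncomputable def padePoly {m : ℕ} (k n : ℕ) (e : Fin m → ℝ) : ℝ[X] →ₗ[ℝ] ℝ[X] :=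
  diagOp (fun u => ((u + n).choose n : ℝ) ^ k) ∘ₗ
    LinearMap.mulLeft ℝ (∏ i, (X - C (e i)) ^ (k * n))

theorem padePoly_apply {m : ℕ} (k n : ℕ) (e : Fin m → ℝ) (Q : ℝ[X]) :
    padePoly k n e Q = diagOp (fun u => ((u + n).choose n : ℝ) ^ k)
      ((∏ i, (X - C (e i)) ^ (k * n)) * Q) := rfl

theorem polylogFunctional_X_pow_mul_padePoly {m k n : ℕ} (e : Fin m → ℝ) (Q : ℝ[X]) (i : Fin m)
    {j s : ℕ} (hj : j < n) (hs : 1 ≤ s) (hsk : s ≤ k) :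
    polylogFunctional (e i) s (X ^ j * padePoly k n e Q) = 0 :=
  polylogFunctional_X_pow_mul_diagOp_eq_zero hj hs hsk
    ((Finset.dvd_prod_of_mem _ (Finset.mem_univ i)).mul_right Q)

theorem monic_prod_X_sub_C_pow {m : ℕ} (e : Fin m → ℝ) (N : ℕ) :
    (∏ i, (X - C (e i)) ^ N).Monic :=
  monic_prod_of_monic _ _ fun _ _ => (monic_X_sub_C _).pow _

theorem natDegree_prod_X_sub_C_pow {m : ℕ} (e : Fin m → ℝ) (N : ℕ) :
    (∏ i, (X - C (e i)) ^ N).natDegree = m * N := by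
  rw [natDegree_prod_of_monic _ _ fun _ _ => (monic_X_sub_C _).pow _]
  simp [natDegree_pow]

theorem natDegree_padePoly_le {m k n : ℕ} (e : Fin m → ℝ) {Q : ℝ[X]} (hQ : Q.natDegree ≤ m * k) :
    (padePoly k n e Q).natDegree ≤ m * (k * (n + 1)) := by
  refine (natDegree_diagOp_le _ _).trans (natDegree_mul_le.trans ?_)
  rw [natDegree_prod_X_sub_C_pow]
  calc m * (k * n) + Q.natDegree ≤ m * (k * n) + m * k := by gcongr
    _ = m * (k * (n + 1)) := by ring

theorem natDegree_divByMonic_X_sub_C_lt {P : ℝ[X]} {z : ℝ} (h : P /ₘ (X - C z) ≠ 0) :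
    (P /ₘ (X - C z)).natDegree < P.natDegree := by
  rw [natDegree_divByMonic _ (monic_X_sub_C z), natDegree_X_sub_C]
  have : P.natDegree ≠ 0 := by
    intro h0
    rw [eq_C_of_natDegree_eq_zero h0] at h
    exact h ((divByMonic_eq_zero_iff (monic_X_sub_C z)).mpr
      (degree_C_le.trans_lt (by rw [degree_X_sub_C]; exact zero_lt_one)))
  omega

theorem eq_zero_of_padeVector_padePoly_eq_zero {m k n : ℕ} {e : Fin m → ℝ}
    (he : Function.Injective e) (he0 : ∀ i, e i ≠ 0) {z : ℝ} {Q : ℝ[X]}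
    (hQ : Q.natDegree ≤ m * k) (h : padeVector k e z (padePoly k n e Q) = 0) : Q = 0 := by
  set P := padePoly k n e Q with hP
  have hz : P.eval z = 0 := congrFun h none
  have hmul : (X - C z) * (P /ₘ (X - C z)) = P := by
    rw [X_sub_C_mul_divByMonic, hz, C_0, sub_zero]
  have hquot : P /ₘ (X - C z) = 0 := by
    by_contra hne
    refine hne (eq_zero_of_polylogFunctional_eq_zero (k := k) (n := n) he he0 ?_ ?_)
    · refine degree_le_natDegree.trans_lt (Nat.cast_lt.mpr ?_)
      exact (natDegree_divByMonic_X_sub_C_lt hne).trans_le (natDegree_padePoly_le e hQ)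
    · intro i j hj s hs hsk
      induction j with
      | zero =>
        have := congrFun h (some (i, ⟨s - 1, by omega⟩))
        simpa [padeVector, Nat.sub_add_cancel hs] using this
      | succ j ih =>
        have h1 := polylogFunctional_X_pow_mul_padePoly e Q i hj hs hsk
        rw [← hP, ← hmul, show X ^ j * ((X - C z) * (P /ₘ (X - C z)))
          = X ^ (j + 1) * (P /ₘ (X - C z)) - z • (X ^ j * (P /ₘ (X - C z))) by
            rw [smul_eq_C_mul]; ring, map_sub, map_smul, ih (by omega)] at h1
        simpa using h1
  rw [hquot, mul_zero] at hmul
  have h2 := eq_zero_of_diagOp_eq_zero (fun u => pow_ne_zero k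
    (Nat.cast_ne_zero.mpr (Nat.choose_pos (Nat.le_add_left n u)).ne')) (hP.symm.trans hmul.symm)
  exact (mul_eq_zero.mp h2).resolve_left (monic_prod_X_sub_C_pow e _).ne_zero

/-- The Padé vectors attached to `1, X, …, X^(m * k)` span the whole space. -/
theorem eq_zero_of_sum_mul_padeVector_eq_zero {m k n : ℕ} {e : Fin m → ℝ}
    (he : Function.Injective e) (he0 : ∀ i, e i ≠ 0) {z : ℝ}
    {c : Option (Fin m × Fin k) → ℝ}
    (h : ∀ l ≤ m * k, ∑ x, c x * padeVector k e z (padePoly k n e (X ^ l)) x = 0) : c = 0 := by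
  set T : degreeLT ℝ (m * k + 1) →ₗ[ℝ] (Option (Fin m × Fin k) → ℝ) :=
    (padeVector k e z ∘ₗ padePoly k n e) ∘ₗ (degreeLT ℝ (m * k + 1)).subtype with hT
  have hdeg (Q : degreeLT ℝ (m * k + 1)) : (Q : ℝ[X]).natDegree < m * k + 1 := by
    rcases eq_or_ne (Q : ℝ[X]) 0 with h0 | h0
    · simp [h0]
    · exact (natDegree_lt_iff_degree_lt h0).mpr (mem_degreeLT.mp Q.2)
  have hinj : Function.Injective T := by
    rw [injective_iff_map_eq_zero]
    intro Q hQ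
    exact Subtype.ext (eq_zero_of_padeVector_padePoly_eq_zero he he0
      (Nat.lt_succ_iff.mp (hdeg Q)) hQ)
  have : FiniteDimensional ℝ (degreeLT ℝ (m * k + 1)) :=
    Module.Finite.equiv (degreeLTEquiv ℝ (m * k + 1)).symm
  have hsurj : Function.Surjective T := by
    refine (LinearMap.injective_iff_surjective_of_finrank_eq_finrank ?_).mp hinj
    rw [(degreeLTEquiv ℝ (m * k + 1)).finrank_eq]
    simp
  have hzero (Q : degreeLT ℝ (m * k + 1)) : ∑ x, c x * T Q x = 0 := by
    have h1 : T Q = ∑ l ∈ Finset.range (m * k + 1),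
        (Q : ℝ[X]).coeff l • padeVector k e z (padePoly k n e (X ^ l)) := by
      conv_lhs => rw [hT]
      simp only [LinearMap.comp_apply, Submodule.subtype_apply]
      rw [as_sum_range' (Q : ℝ[X]) _ (hdeg Q)]
      simp only [map_sum, ← smul_X_eq_monomial, map_smul, finsetSum_coeff]
      refine Finset.sum_congr rfl fun l hl => ?_
      simp [coeff_X_pow, Finset.mem_range.mp hl]
    simp only [h1, Finset.sum_apply, Pi.smul_apply, smul_eq_mul, Finset.mul_sum]
    rw [Finset.sum_comm]
    refine Finset.sum_eq_zero fun l hl => ?_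
    simp only [mul_left_comm (c _), ← Finset.mul_sum]
    rw [h l (Nat.lt_succ_iff.mp (Finset.mem_range.mp hl)), mul_zero]
  classical
  funext x
  obtain ⟨Q, hQ⟩ := hsurj (Pi.single x 1)
  have := hzero Q
  rw [hQ] at this
  simpa [Pi.single_apply] using this

end PolynomialFunctionals

section PolynomialFunctionalBounds

open Polynomial Filter Topology

/-- The weighted length `∑ |aᵤ| dᵘ` of the polynomial `∑ aᵤ Xᵘ`. -/
noncomputable def polyWeight (d : ℝ) (P : ℝ[X]) : ℝ := ∑ u ∈ P.support, |P.coeff u| * d ^ u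

theorem polyWeight_nonneg {d : ℝ} (hd : 0 ≤ d) (P : ℝ[X]) : 0 ≤ polyWeight d P :=
  Finset.sum_nonneg fun _ _ => by positivity

theorem abs_polylogFunctional_X_pow_mul_le {e d : ℝ} (he : |e| ≤ d) (s j : ℕ) (P : ℝ[X]) :
    |polylogFunctional e s (X ^ j * P)| ≤ d ^ (j + 1) * polyWeight d P := by
  have hd : 0 ≤ d := (abs_nonneg e).trans he
  rw [polylogFunctional_X_pow_mul, abs_mul, abs_pow]
  refine mul_le_mul (by gcongr) ?_ (abs_nonneg _) (by positivity)
  rw [weightedSum_eq_sum]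
  refine (Finset.abs_sum_le_sum_abs _ _).trans (Finset.sum_le_sum fun u _ => ?_)
  rw [abs_mul, abs_div, abs_pow, mul_comm]
  have h1 : 1 ≤ |((u : ℝ) + j + 1) ^ s| := by
    rw [abs_of_nonneg (by positivity)]
    exact one_le_pow₀ (by linarith [(Nat.cast_nonneg u : (0 : ℝ) ≤ u),
      (Nat.cast_nonneg j : (0 : ℝ) ≤ j)])
  gcongr
  exact (div_le_self (by positivity) h1).trans (by gcongr)

theorem polylogFunctional_eq_add (e z : ℝ) (s j : ℕ) (P : ℝ[X]) :
    polylogFunctional e s (X ^ j * P) =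
      polylogFunctional e s (X ^ (j + 1) * (P /ₘ (X - C z)))
        - z * polylogFunctional e s (X ^ j * (P /ₘ (X - C z)))
        + P.eval z * (e ^ (j + 1) / ((j : ℝ) + 1) ^ s) := by
  have h1 : polylogFunctional e s (X ^ j) = e ^ (j + 1) / ((j : ℝ) + 1) ^ s := by
    rw [polylogFunctional, X_pow_eq_monomial, weightedSum_monomial, mul_one]
  have h2 := X_sub_C_mul_divByMonic P z
  rw [← h1, ← smul_eq_mul z, ← smul_eq_mul (P.eval z), ← map_smul, ← map_smul, ← map_sub,
    ← map_add]
  congr 1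
  rw [smul_eq_C_mul, smul_eq_C_mul]
  linear_combination -(X ^ j) * h2

theorem sum_range_polylogFunctional (e : ℝ) {z : ℝ} (hz : z ≠ 0) (s J : ℕ) (P : ℝ[X]) :
    P.eval z * ∑ j ∈ Finset.range J, (e / z) ^ (j + 1) / ((j : ℝ) + 1) ^ s
        - polylogFunctional e s (P /ₘ (X - C z)) =
      ∑ j ∈ Finset.range J, polylogFunctional e s (X ^ j * P) / z ^ (j + 1)
        - polylogFunctional e s (X ^ J * (P /ₘ (X - C z))) / z ^ J := by
  induction J with
  | zero => simp
  | succ J ih =>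
    rw [Finset.sum_range_succ, Finset.sum_range_succ, polylogFunctional_eq_add e z s J P, mul_add,
      add_sub_right_comm, ih, div_pow]
    field_simp
    ring

theorem abs_sum_range_polylogFunctional_le {e d z : ℝ} (he : |e| ≤ d) (hz : 2 * d ≤ |z|)
    (hz0 : z ≠ 0) {n s : ℕ} {P : ℝ[X]} (h : ∀ j < n, polylogFunctional e s (X ^ j * P) = 0)
    (J : ℕ) (hJ : n ≤ J) :
    |∑ j ∈ Finset.range J, polylogFunctional e s (X ^ j * P) / z ^ (j + 1)| ≤
      polyWeight d P * ((d / |z|) ^ n - (d / |z|) ^ J) := by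
  have hd : 0 ≤ d := (abs_nonneg e).trans he
  have hzp : 0 < |z| := abs_pos.mpr hz0
  induction J, hJ using Nat.le_induction with
  | base =>
    rw [Finset.sum_eq_zero fun j hj => by rw [h j (Finset.mem_range.mp hj), zero_div]]
    simp
  | succ J hJ ih =>
    rw [Finset.sum_range_succ]
    refine (abs_add_le _ _).trans ?_
    have h1 : |polylogFunctional e s (X ^ J * P) / z ^ (J + 1)| ≤
        polyWeight d P * (d / |z|) ^ (J + 1) := by
      rw [abs_div, abs_pow, div_pow, mul_div_assoc', mul_comm (polyWeight d P)]
      gcongr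
      exact abs_polylogFunctional_X_pow_mul_le he s J P
    have h2 : d / |z| ≤ 1 / 2 := by
      rw [div_le_div_iff₀ hzp two_pos]
      linarith
    have h3 : (d / |z|) ^ (J + 1) ≤ (d / |z|) ^ J * (1 / 2) := by
      rw [pow_succ]
      gcongr
    have h4 := mul_le_mul_of_nonneg_left h3 (polyWeight_nonneg hd P)
    linarith

theorem summable_liR {x : ℝ} (hx : |x| < 1) (s : ℕ) :
    Summable fun t : ℕ => x ^ (t + 1) / ((t : ℝ) + 1) ^ s := by
  refine Summable.of_norm_bounded (g := fun t => |x| ^ (t + 1))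
    ((summable_nat_add_iff 1).mpr (summable_geometric_of_lt_one (abs_nonneg x) hx)) fun t => ?_
  rw [Real.norm_eq_abs, abs_div, abs_pow]
  refine div_le_self (by positivity) ?_
  rw [abs_of_nonneg (by positivity)]
  exact one_le_pow₀ (by linarith [(Nat.cast_nonneg t : (0 : ℝ) ≤ t)])

/-- The remainder of a Padé approximation of order `n` is small. -/
theorem abs_eval_mul_liR_sub_polylogFunctional_le {e d z : ℝ} (he : |e| ≤ d) (hz : 2 * d ≤ |z|)
    (hz0 : z ≠ 0) {n s : ℕ} {P : ℝ[X]} (h : ∀ j < n, polylogFunctional e s (X ^ j * P) = 0) :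
    |P.eval z * liR s (e / z) - polylogFunctional e s (P /ₘ (X - C z))| ≤
      polyWeight d P * (d / |z|) ^ n := by
  have hd : 0 ≤ d := (abs_nonneg e).trans he
  have hzp : 0 < |z| := abs_pos.mpr hz0
  have h2 : d / |z| ≤ 1 / 2 := by
    rw [div_le_div_iff₀ hzp two_pos]
    linarith
  have hx : |e / z| < 1 := by
    rw [abs_div]
    have : |e| / |z| ≤ d / |z| := by gcongr
    linarith
  have hlim : Tendsto (fun J => |P.eval z * ∑ j ∈ Finset.range J, (e / z) ^ (j + 1) /
      ((j : ℝ) + 1) ^ s - polylogFunctional e s (P /ₘ (X - C z))|) atTop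
      (𝓝 |P.eval z * liR s (e / z) - polylogFunctional e s (P /ₘ (X - C z))|) :=
    (((summable_liR hx s).hasSum.tendsto_sum_nat.const_mul _).sub_const _).abs
  have hlim' : Tendsto (fun J => polyWeight d P * (d / |z|) ^ n +
      d * polyWeight d (P /ₘ (X - C z)) * (d / |z|) ^ J) atTop
      (𝓝 (polyWeight d P * (d / |z|) ^ n + d * polyWeight d (P /ₘ (X - C z)) * 0)) :=
    ((tendsto_pow_atTop_nhds_zero_of_lt_one (by positivity) (by linarith)).const_mul _).const_add _
  rw [mul_zero, add_zero] at hlim'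
  refine le_of_tendsto_of_tendsto hlim hlim' ?_
  filter_upwards [eventually_ge_atTop n] with J hJ
  rw [sum_range_polylogFunctional e hz0]
  refine (abs_sub _ _).trans (add_le_add ?_ ?_)
  · refine (abs_sum_range_polylogFunctional_le he hz hz0 h J hJ).trans ?_
    gcongr
    · exact polyWeight_nonneg hd P
    · have : 0 ≤ (d / |z|) ^ J := by positivity
      linarith
  · rw [abs_div, abs_pow, div_pow, mul_div_assoc']
    gcongr
    refine (abs_polylogFunctional_X_pow_mul_le he s J _).trans (le_of_eq ?_)
    ring

theorem abs_coeff_mul_le {F F' G G' : ℝ[X]} (hF : ∀ u, |F.coeff u| ≤ F'.coeff u)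
    (hG : ∀ u, |G.coeff u| ≤ G'.coeff u) (u : ℕ) : |(F * G).coeff u| ≤ (F' * G').coeff u := by
  rw [coeff_mul, coeff_mul]
  refine (Finset.abs_sum_le_sum_abs _ _).trans (Finset.sum_le_sum fun x _ => ?_)
  rw [abs_mul]
  exact mul_le_mul (hF _) (hG _) (abs_nonneg _) ((abs_nonneg _).trans (hF _))

theorem abs_coeff_one_le (u : ℕ) : |(1 : ℝ[X]).coeff u| ≤ (1 : ℝ[X]).coeff u := by
  rw [coeff_one]
  split_ifs <;> simp

theorem abs_coeff_pow_le {F F' : ℝ[X]} (hF : ∀ u, |F.coeff u| ≤ F'.coeff u) (N : ℕ) (u : ℕ) :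
    |(F ^ N).coeff u| ≤ (F' ^ N).coeff u := by
  induction N generalizing u with
  | zero => simpa using abs_coeff_one_le u
  | succ N ih =>
    rw [pow_succ, pow_succ]
    exact abs_coeff_mul_le ih hF u

theorem abs_coeff_prod_le {ι : Type*} (s : Finset ι) {F F' : ι → ℝ[X]}
    (hF : ∀ i u, |(F i).coeff u| ≤ (F' i).coeff u) (u : ℕ) :
    |(∏ i ∈ s, F i).coeff u| ≤ (∏ i ∈ s, F' i).coeff u := by
  classical
  induction s using Finset.induction_on generalizing u with
  | empty => simpa using abs_coeff_one_le u
  | insert a s ha ih =>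
    rw [Finset.prod_insert ha, Finset.prod_insert ha]
    exact abs_coeff_mul_le (hF a) ih u

theorem abs_coeff_X_sub_C_le {e : ℝ} (he : 0 ≤ e) (u : ℕ) :
    |(X - C e : ℝ[X]).coeff u| ≤ (X + C e : ℝ[X]).coeff u := by
  rw [coeff_sub, coeff_add, coeff_X, coeff_C]
  split_ifs with h1 h2 <;> simp_all [abs_of_nonneg]

theorem polyWeight_diagOp_le {d A : ℝ} (hd : 0 ≤ d) {c : ℕ → ℝ} {F G : ℝ[X]} (hA : 0 ≤ A)
    (hc : ∀ u ≤ F.natDegree, |c u| ≤ A) (hF : ∀ u, |F.coeff u| ≤ G.coeff u) :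
    polyWeight d (diagOp c F) ≤ A * G.eval d := by
  have hsub : (diagOp c F).support ⊆ G.support := by
    intro u hu
    rw [mem_support_iff, coeff_diagOp] at hu
    rw [mem_support_iff]
    intro h0
    have := hF u
    rw [h0] at this
    exact hu (by rw [abs_nonpos_iff.mp this, mul_zero])
  rw [eval_eq_sum, Polynomial.sum_def, Finset.mul_sum, polyWeight]
  refine (Finset.sum_le_sum fun u hu => ?_).trans (Finset.sum_le_sum_of_subset_of_nonneg hsub
    fun u _ _ => mul_nonneg hA (mul_nonneg ((abs_nonneg _).trans (hF u)) (pow_nonneg hd u)))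
  rw [← mul_assoc]
  refine mul_le_mul_of_nonneg_right ?_ (pow_nonneg hd u)
  rw [coeff_diagOp, abs_mul]
  refine mul_le_mul (hc u ?_) (hF u) (abs_nonneg _) hA
  exact (le_natDegree_of_mem_supp u hu).trans (natDegree_diagOp_le c F)

theorem polyWeight_padePoly_X_pow_le {m k n l : ℕ} {d : ℝ} (hd : 1 ≤ d) {e : Fin m → ℝ}
    (he0 : ∀ i, 0 ≤ e i) (hed : ∀ i, e i ≤ d) (hl : l ≤ m * k) :
    polyWeight d (padePoly k n e (X ^ l)) ≤
      ((m * (k * (n + 1)) + n).choose n : ℝ) ^ k * ((2 * d) ^ (m * (k * n)) * d ^ (m * k)) := by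
  have hd0 : 0 ≤ d := zero_le_one.trans hd
  rw [padePoly_apply]
  refine (polyWeight_diagOp_le (G := (∏ i, (X + C (e i)) ^ (k * n)) * X ^ l) hd0
    (by positivity : (0 : ℝ) ≤ ((m * (k * (n + 1)) + n).choose n : ℝ) ^ k) ?_ ?_).trans ?_
  · intro u hu
    rw [abs_of_nonneg (by positivity)]
    have hu' : u ≤ m * (k * (n + 1)) := by
      refine hu.trans (natDegree_mul_le.trans ?_)
      rw [natDegree_prod_X_sub_C_pow, natDegree_X_pow]
      calc m * (k * n) + l ≤ m * (k * n) + m * k := by gcongr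
        _ = m * (k * (n + 1)) := by ring
    gcongr
  · refine abs_coeff_mul_le
      (abs_coeff_prod_le _ fun i => abs_coeff_pow_le (abs_coeff_X_sub_C_le (he0 i)) _) fun u => ?_
    rw [coeff_X_pow]
    split_ifs <;> simp
  · gcongr
    rw [eval_mul, eval_pow, eval_X, eval_prod]
    gcongr
    · refine (Finset.prod_le_prod (g := fun _ => (2 * d) ^ (k * n)) (fun i _ => ?_)
        fun i _ => ?_).trans ?_
      · have := he0 i
        simp only [eval_pow, eval_add, eval_X, eval_C]
        positivity
      · have := he0 i
        have := hed i
        simp only [eval_pow, eval_add, eval_X, eval_C]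
        gcongr
        linarith
      · rw [Finset.prod_const, Finset.card_univ, Fintype.card_fin, ← pow_mul, mul_comm m]

end PolynomialFunctionalBounds

section Integrality

open Polynomial

theorem prod_X_sub_C_pow_mem_lifts {m : ℕ} (N : ℕ) {e : Fin m → ℝ}
    (he : ∀ i, e i ∈ Set.range (Int.cast : ℤ → ℝ)) :
    ∏ i, (X - C (e i)) ^ N ∈ lifts (Int.castRingHom ℝ) := by
  refine prod_mem fun i _ => pow_mem ?_ _
  obtain ⟨a, ha⟩ := he i
  exact (mem_lifts _).mpr ⟨X - C a, by simp [← ha]⟩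

theorem padePoly_X_pow_mem_lifts {m : ℕ} (k n l : ℕ) {e : Fin m → ℝ}
    (he : ∀ i, e i ∈ Set.range (Int.cast : ℤ → ℝ)) :
    padePoly k n e (X ^ l) ∈ lifts (Int.castRingHom ℝ) := by
  have h : (∏ i, (X - C (e i)) ^ (k * n)) * X ^ l ∈ lifts (Int.castRingHom ℝ) :=
    mul_mem (prod_X_sub_C_pow_mem_lifts _ he) ((mem_lifts _).mpr ⟨X ^ l, by simp⟩)
  rw [lifts_iff_coeff_lifts] at h ⊢
  intro u
  obtain ⟨a, ha⟩ := h u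
  refine ⟨((u + n).choose n : ℤ) ^ k * a, ?_⟩
  rw [padePoly_apply, coeff_diagOp, ← ha]
  simp

theorem divByMonic_X_sub_C_mem_lifts {P : ℝ[X]} (hP : P ∈ lifts (Int.castRingHom ℝ)) (z : ℤ) :
    P /ₘ (X - C (z : ℝ)) ∈ lifts (Int.castRingHom ℝ) := by
  obtain ⟨P', rfl⟩ := (mem_lifts _).mp hP
  refine (mem_lifts _).mpr ⟨P' /ₘ (X - C z), ?_⟩
  rw [map_divByMonic _ (monic_X_sub_C z)]
  simp

theorem dLcm_pow_mul_polylogFunctional_mem_range {M k s : ℕ} (hs : s ≤ k) (e : ℤ) {P : ℝ[X]}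
    (hP : P ∈ lifts (Int.castRingHom ℝ)) (hPM : ∀ u ∈ P.support, u < M) :
    (dLcm M : ℝ) ^ k * polylogFunctional e s P ∈ Set.range (Int.cast : ℤ → ℝ) := by
  change _ ∈ (Int.castRingHom ℝ).range
  rw [polylogFunctional, weightedSum_eq_sum, Finset.mul_sum]
  refine sum_mem fun u hu => ?_
  obtain ⟨a, ha⟩ := (lifts_iff_coeff_lifts P).mp hP u
  obtain ⟨b, hb⟩ : u + 1 ∣ dLcm M :=
    Finset.dvd_lcm (f := id) (Finset.mem_Icc.mpr ⟨Nat.succ_pos u, hPM u hu⟩)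
  obtain ⟨t, rfl⟩ := Nat.exists_eq_add_of_le hs
  refine ⟨(dLcm M : ℤ) ^ t * b ^ s * e ^ (u + 1) * a, ?_⟩
  have h1 : (dLcm M : ℝ) = ((u : ℝ) + 1) * b := by rw [hb]; push_cast; ring
  have h2 : ((u : ℝ) + 1) ≠ 0 := by positivity
  rw [← ha, add_comm s t, pow_add (dLcm M : ℝ)]
  simp only [map_mul, map_pow, eq_intCast, Int.cast_natCast]
  rw [h1, mul_pow _ _ s]
  field_simp

theorem dLcm_pow_mul_padeVector_mem_range {m k n l : ℕ} {e : Fin m → ℝ}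
    (he : ∀ i, e i ∈ Set.range (Int.cast : ℤ → ℝ)) (z : ℤ) (hl : l ≤ m * k)
    (x : Option (Fin m × Fin k)) :
    (dLcm (m * (k * (n + 1))) : ℝ) ^ k * padeVector k e z (padePoly k n e (X ^ l)) x ∈
      Set.range (Int.cast : ℤ → ℝ) := by
  have hP := padePoly_X_pow_mem_lifts k n l he
  have hdeg := natDegree_padePoly_le (n := n) e
    (show (X ^ l : ℝ[X]).natDegree ≤ m * k by rwa [natDegree_X_pow])
  set P := padePoly k n e (X ^ l)
  rcases x with _ | ⟨i, s⟩
  · obtain ⟨P', hP'⟩ := (mem_lifts _).mp hP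
    refine ⟨(dLcm (m * (k * (n + 1))) : ℤ) ^ k * P'.eval z, ?_⟩
    change _ = _ * P.eval (z : ℝ)
    rw [← hP', eval_intCast_map]
    simp
  · obtain ⟨a, ha⟩ := he i
    change _ * polylogFunctional (e i) ((s : ℕ) + 1) (P /ₘ (X - C (z : ℝ))) ∈ _
    rw [← ha]
    refine dLcm_pow_mul_polylogFunctional_mem_range s.2 a (divByMonic_X_sub_C_mem_lifts hP z)
      fun u hu => ?_
    have hne : P /ₘ (X - C (z : ℝ)) ≠ 0 := by
      intro h0
      rw [h0] at hu
      simp at hu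
    exact ((le_natDegree_of_mem_supp u hu).trans_lt (natDegree_divByMonic_X_sub_C_lt hne)).trans_le
      hdeg

end Integrality

section PrimeCounting

open Filter Chebyshev ArithmeticFunction

theorem log_factorial_eq_sum_psi (n : ℕ) :
    Real.log n.factorial = ∑ j ∈ Finset.Ioc 0 n, psi ((n / j : ℕ) : ℝ) := by
  have h1 : Real.log n.factorial = ∑ j ∈ Finset.Ioc 0 n, ArithmeticFunction.log j := by
    induction n with
    | zero => simp
    | succ n ih =>
      rw [← Finset.insert_Ioc_right_eq_Ioc_add_one (Nat.zero_le n), Finset.sum_insert (by simp),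
        ← ih, Nat.factorial_succ, Nat.cast_mul, Real.log_mul (by positivity) (by positivity),
        log_apply]
  rw [h1, ← zeta_mul_vonMangoldt, sum_Ioc_mul_eq_sum_sum]
  refine Finset.sum_congr rfl fun j hj => ?_
  rw [natCoe_apply, zeta_apply_ne (Finset.mem_Ioc.mp hj).1.ne', Nat.cast_one, one_mul, psi,
    Nat.floor_natCast]

theorem exists_psi_lt {c : ℝ} (hc : 1 < c) (B : ℝ) : ∃ j : ℕ, psi (j : ℝ) < c * j - B := by
  by_contra! h
  have key : ∀ n : ℕ, 0 < n → (c - 1) * Real.log n ≤ c + B := by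
    intro n hn
    have hn' : (0 : ℝ) < n := by exact_mod_cast hn
    have h1 : Real.log n.factorial ≤ n * Real.log n := by
      rw [← Real.log_pow]
      exact Real.log_le_log (by positivity) (by exact_mod_cast Nat.factorial_le_pow n)
    have h2 : ∑ j ∈ Finset.Ioc 0 n, (c * n * (j : ℝ)⁻¹ - (c + B)) ≤ Real.log n.factorial := by
      rw [log_factorial_eq_sum_psi]
      refine Finset.sum_le_sum fun j hj => ?_
      have h3 : (n : ℝ) * (j : ℝ)⁻¹ - 1 ≤ (n / j : ℕ) := by
        rw [← div_eq_mul_inv, ← Nat.floor_div_eq_div (K := ℝ)]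
        exact (Nat.sub_one_lt_floor _).le
      have := mul_le_mul_of_nonneg_left h3 (zero_le_one.trans hc.le)
      linarith [h (n / j)]
    rw [Finset.sum_sub_distrib, ← Finset.mul_sum, Finset.sum_const, Nat.card_Ioc, nsmul_eq_mul,
      Nat.sub_zero] at h2
    have h4 : Real.log n ≤ ∑ j ∈ Finset.Ioc 0 n, (j : ℝ)⁻¹ := by
      have := log_add_one_le_harmonic n
      rw [harmonic_eq_sum_Icc] at this
      push_cast at this
      exact (Real.log_le_log hn' (by linarith)).trans this
    have h5 := mul_le_mul_of_nonneg_left h4 (by positivity : 0 ≤ c * n)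
    have h6 : (n : ℝ) * ((c - 1) * Real.log n) ≤ n * (c + B) := by linarith
    exact le_of_mul_le_mul_left h6 hn'
  have hlim : Tendsto (fun n : ℕ => (c - 1) * Real.log n) atTop atTop :=
    (Real.tendsto_log_atTop.comp tendsto_natCast_atTop_atTop).const_mul_atTop (by linarith)
  obtain ⟨n, hn, hn'⟩ := ((hlim.eventually_gt_atTop (c + B)).and (eventually_gt_atTop 0)).exists
  exact (key n hn').not_gt hn

theorem frequently_psi_le {c : ℝ} (hc : 1 < c) {a : ℕ} (ha : 0 < a) :
    ∃ᶠ n : ℕ in atTop, psi ((a * (n + 1) : ℕ) : ℝ) ≤ c * (a * (n + 1) : ℕ) := by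
  intro h
  obtain ⟨N, hN⟩ := eventually_atTop.mp h
  obtain ⟨j, hj⟩ := exists_psi_lt hc (c * (a * (N + 1) : ℕ))
  have hc0 : 0 < c := zero_lt_one.trans hc
  have hlt : a * (N + 1) < j := by
    by_contra! hle
    have : (j : ℝ) ≤ (a * (N + 1) : ℕ) := by exact_mod_cast hle
    have := mul_le_mul_of_nonneg_left this hc0.le
    linarith [psi_nonneg (j : ℝ)]
  obtain ⟨n, hn⟩ : ∃ n, j / a = n + 1 :=
    Nat.exists_eq_succ_of_ne_zero (Nat.div_pos (by nlinarith) ha).ne'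
  have hnN : N ≤ n := by
    have : N + 1 ≤ j / a := (Nat.le_div_iff_mul_le ha).mpr (by linarith)
    omega
  have h1 : psi ((a * (n + 1) : ℕ) : ℝ) ≤ psi j :=
    psi_mono (by exact_mod_cast hn ▸ Nat.mul_div_le j a)
  have h2 : (j : ℝ) ≤ (a * (n + 1) : ℕ) + (a * (N + 1) : ℕ) := by
    have := Nat.div_add_mod j a
    have := Nat.mod_lt j ha
    rw [hn] at *
    have : j ≤ a * (n + 1) + a * (N + 1) := by nlinarith
    exact_mod_cast this
  have := hN n hnN
  nlinarith

theorem dLcm_pos (n : ℕ) : 0 < dLcm n := Nat.pos_of_ne_zero (by simp [dLcm])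

theorem frequently_dLcm_le {c : ℝ} (hc : 1 < c) {a : ℕ} (ha : 0 < a) :
    ∃ᶠ n : ℕ in atTop, (dLcm (a * (n + 1)) : ℝ) ≤ Real.exp (c * (a * (n + 1))) := by
  refine (frequently_psi_le hc ha).mono fun n hn => ?_
  rw [psi_eq_log_lcmUpto] at hn
  rw [← Real.log_le_iff_le_exp (by exact_mod_cast dLcm_pos _)]
  exact_mod_cast hn

theorem choose_add_le (a : ℕ) {n : ℕ} (hn : 0 < n) :
    ((a * (n + 1) + n).choose n : ℝ) ≤ Real.exp 1 * (Real.exp 1 * (a + 1)) ^ n := by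
  have hn' : (0 : ℝ) < n := by exact_mod_cast hn
  calc ((a * (n + 1) + n).choose n : ℝ) ≤ ((a * (n + 1) + n : ℕ) : ℝ) ^ n / n.factorial :=
        Nat.choose_le_pow_div _ _
    _ ≤ ((1 / n + 1) * (a + 1) * n) ^ n / n.factorial := by
        gcongr
        have : (1 / n + 1) * (a + 1) * n = (a * (n + 1) + n : ℝ) + 1 := by field_simp; ring
        rw [this]
        push_cast
        linarith
    _ = (1 / n + 1 : ℝ) ^ n * (a + 1) ^ n * ((n : ℝ) ^ n / n.factorial) := by
        rw [mul_pow, mul_pow]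
        ring
    _ ≤ Real.exp (1 / n) ^ n * (a + 1) ^ n * Real.exp n := by
        gcongr
        · exact Real.add_one_le_exp _
        · exact Real.pow_div_factorial_le_exp _ n.cast_nonneg n
    _ = Real.exp 1 * (Real.exp 1 * (a + 1)) ^ n := by
        rw [mul_pow, ← Real.exp_nat_mul, ← Real.exp_nat_mul, mul_one_div_cancel hn'.ne', mul_one]
        ring

theorem frequently_dLcm_pow_mul_lt_one {m k : ℕ} (hm : 0 < m) (hk : 0 < k) {d x : ℝ} (hd : 1 ≤ d)
    (hx : 0 < x) (h : (k : ℝ) ^ 2 * m + k * m * Real.log (2 * d) + k * Real.log (k * m + 1) + k <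
      Real.log x) {S : ℝ} (hS : 0 ≤ S) :
    ∃ᶠ n : ℕ in atTop, (dLcm (m * (k * (n + 1))) : ℝ) ^ k *
      (S * (((m * (k * (n + 1)) + n).choose n : ℝ) ^ k * ((2 * d) ^ (m * (k * n)) * d ^ (m * k)) *
        (1 / x) ^ n)) < 1 := by
  have hkm : (0 : ℝ) < (k : ℝ) ^ 2 * m := by positivity
  obtain ⟨c, hc, hcx⟩ : ∃ c : ℝ, 1 < c ∧ c * ((k : ℝ) ^ 2 * m) +
      k * m * Real.log (2 * d) + k * Real.log (k * m + 1) + k < Real.log x := by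
    obtain ⟨c, hc, hc'⟩ := exists_between (show 1 < (Real.log x - k * m * Real.log (2 * d) -
      k * Real.log (k * m + 1) - k) / ((k : ℝ) ^ 2 * m) by
        rw [lt_div_iff₀ hkm]
        linarith)
    rw [lt_div_iff₀ hkm] at hc'
    exact ⟨c, hc, by linarith⟩
  set E : ℝ := Real.exp (c * (m * k)) with hE
  set A : ℝ := Real.exp 1 * (m * k + 1) with hA
  have hA0 : 0 < A := by positivity
  have hr : E ^ k * A ^ k * (2 * d) ^ (m * k) / x < 1 := by
    rw [div_lt_one hx, ← Real.log_lt_log_iff (by positivity) hx, Real.log_mul (by positivity)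
      (by positivity), Real.log_mul (by positivity) (by positivity), Real.log_pow, Real.log_pow,
      Real.log_pow, hE, hA, Real.log_mul (by positivity) (by positivity), Real.log_exp,
      Real.log_exp, mul_comm (m : ℝ) k]
    push_cast
    linarith
  have hlim : Tendsto (fun n : ℕ => E ^ k * S * (Real.exp 1 ^ k * d ^ (m * k)) *
      (E ^ k * A ^ k * (2 * d) ^ (m * k) / x) ^ n) atTop (nhds 0) := by
    simpa using (tendsto_pow_atTop_nhds_zero_of_lt_one (by positivity) hr).const_mul
      (E ^ k * S * (Real.exp 1 ^ k * d ^ (m * k)))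
  refine ((frequently_dLcm_le hc (Nat.mul_pos hm hk)).and_eventually
    ((hlim.eventually_lt_const one_pos).and (eventually_gt_atTop 0))).mono
    fun n ⟨h1, h2, h3⟩ => lt_of_le_of_lt ?_ h2
  have h4 := choose_add_le (m * k) h3
  rw [mul_assoc] at h1 h4
  push_cast at h1 h4
  calc _ ≤ Real.exp (c * (m * k * (n + 1))) ^ k *
      (S * ((Real.exp 1 * A ^ n) ^ k * ((2 * d) ^ (m * (k * n)) * d ^ (m * k)) * (1 / x) ^ n)) := by
        gcongr
    _ = _ := by
        have : Real.exp (c * (m * k * (n + 1))) = E * E ^ n := by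
          rw [hE, ← Real.exp_nat_mul, ← Real.exp_add]
          ring_nf
        rw [this]
        simp only [div_pow, mul_pow, one_pow, ← pow_mul]
        rw [← mul_assoc m k n]
        ring

end PrimeCounting

/-- Linear independence over `ℚ` may be tested against integer coefficients. -/
theorem linearIndependent_rat_of_int {ι : Type*} [Fintype ι] {v : ι → ℝ}
    (h : ∀ g : ι → ℤ, ∑ x, (g x : ℝ) * v x = 0 → ∀ x, g x = 0) : LinearIndependent ℚ v := by
  rw [← LinearIndependent.iff_fractionRing ℤ ℚ, Fintype.linearIndependent_iff]
  intro g hg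
  exact h g (by simpa only [zsmul_eq_mul] using hg)

/-- Padé approximation turns a linear relation between polylogarithms into a small combination of
the entries of `padeVector`. -/
theorem abs_sum_mul_padeVector_le {m k n : ℕ} {e : Fin m → ℝ} {d z : ℝ} (hd : 0 ≤ d)
    (he : ∀ i, |e i| ≤ d) (hz : 2 * d ≤ |z|) (hz0 : z ≠ 0) (Q : Polynomial ℝ)
    {g : Option (Fin m × Fin k) → ℝ}
    (hg : ∑ x, g x * x.elim 1 (fun y => liR ((y.2 : ℕ) + 1) (e y.1 / z)) = 0) :
    |∑ x, g x * padeVector k e z (padePoly k n e Q) x| ≤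
      (∑ x, |g x|) * (polyWeight d (padePoly k n e Q) * (d / |z|) ^ n) := by
  set P := padePoly k n e Q
  have h1 : ∑ x, g x * padeVector k e z P x = ∑ x, g x * (padeVector k e z P x -
      P.eval z * x.elim 1 (fun y => liR ((y.2 : ℕ) + 1) (e y.1 / z))) := by
    have : ∑ x, g x * (P.eval z * x.elim 1 (fun y => liR ((y.2 : ℕ) + 1) (e y.1 / z))) = 0 := by
      simp only [mul_left_comm (g _)]
      rw [← Finset.mul_sum, hg, mul_zero]
    simp only [mul_sub]
    rw [Finset.sum_sub_distrib, this, sub_zero]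
  rw [h1, Finset.sum_mul]
  refine (Finset.abs_sum_le_sum_abs _ _).trans (Finset.sum_le_sum fun x _ => ?_)
  rw [abs_mul]
  refine mul_le_mul_of_nonneg_left ?_ (abs_nonneg _)
  rcases x with _ | ⟨i, s⟩
  · have : 0 ≤ polyWeight d P * (d / |z|) ^ n :=
      mul_nonneg (polyWeight_nonneg hd P) (by positivity)
    simpa [padeVector] using this
  · rw [abs_sub_comm]
    exact abs_eval_mul_liR_sub_polylogFunctional_le (he i) hz hz0 fun j hj =>
      polylogFunctional_X_pow_mul_padePoly e Q i hj (Nat.succ_pos _) s.2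

/-- **Second example, full linear independence** (Section 4.2): if the integer `q`
(positive or negative) satisfies
`log |q| > k² m + k m log(2 d_m) + k log(km+1) + k`, then the `km + 1` real numbers
`1` and `Li_j(1/(l q))` for `j = 1, …, k`, `l = 1, …, m` are linearly independent
over `ℚ`. -/
theorem stmt_18 (k m : ℕ) (hk : 1 ≤ k) (hm : 1 ≤ m) (q : ℤ)
    (hq : Real.log |(q : ℝ)| >
      (k : ℝ) ^ 2 * (m : ℝ) + (k : ℝ) * (m : ℝ) * Real.log (2 * ((dLcm m : ℕ) : ℝ))
        + (k : ℝ) * Real.log ((k : ℝ) * (m : ℝ) + 1) + (k : ℝ)) :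
    LinearIndependent ℚ (fun p : Option (Fin m × Fin k) =>
      p.elim (1 : ℝ) (fun x =>
        liR ((x.2 : ℕ) + 1) (1 / ((((x.1 : ℕ) : ℝ) + 1) * (q : ℝ))))) := by
  have hd : 1 ≤ dLcm m := dLcm_pos m
  have hd' : (1 : ℝ) ≤ dLcm m := by exact_mod_cast hd
  have hq1 : 1 < Real.log |(q : ℝ)| := by
    have h1 : (1 : ℝ) ≤ k := by exact_mod_cast hk
    have h2 : 0 ≤ Real.log (2 * (dLcm m : ℝ)) := Real.log_nonneg (by linarith)
    have h3 : 0 ≤ Real.log ((k : ℝ) * m + 1) := Real.log_nonneg (by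
      have : (0 : ℝ) ≤ (k : ℝ) * m := by positivity
      linarith)
    have : 0 < (k : ℝ) ^ 2 * m := by positivity
    have : 0 ≤ (k : ℝ) * m * Real.log (2 * (dLcm m : ℝ)) := by positivity
    have : 0 ≤ k * Real.log ((k : ℝ) * m + 1) := by positivity
    linarith
  have hq0 : (q : ℝ) ≠ 0 := by
    intro h
    rw [h] at hq1
    norm_num at hq1
  have hq2 : 2 ≤ |(q : ℝ)| := by
    linarith [Real.log_le_sub_one_of_pos (abs_pos.mpr hq0)]
  set e : Fin m → ℝ := fun i => (dLcm m : ℝ) / ((i : ℕ) + 1) with he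
  have he0 (i : Fin m) : 0 < e i := by positivity
  have hed (i : Fin m) : e i ≤ dLcm m :=
    div_le_self (by positivity) (by linarith [((i : ℕ).cast_nonneg : (0 : ℝ) ≤ (i : ℕ))])
  have hinj : Function.Injective e := by
    intro i j hij
    have h := inv_injective (mul_left_cancel₀ (by positivity) hij)
    exact Fin.ext (by exact_mod_cast add_right_cancel h)
  have h_range (i : Fin m) : e i ∈ Set.range (Int.cast : ℤ → ℝ) := by
    obtain ⟨b, hb⟩ : (i : ℕ) + 1 ∣ dLcm m :=
      Finset.dvd_lcm (f := id) (Finset.mem_Icc.mpr ⟨Nat.succ_pos _, i.2⟩)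
    refine ⟨b, ?_⟩
    simp only [he, hb]
    push_cast
    field_simp
  set z : ℤ := dLcm m * q with hz
  have hzr : (z : ℝ) = dLcm m * q := by push_cast [hz]; rfl
  have hz0 : (z : ℝ) ≠ 0 := by rw [hzr]; positivity
  have hzabs : |(z : ℝ)| = dLcm m * |(q : ℝ)| := by rw [hzr, abs_mul, Nat.abs_cast]
  have hdz : (dLcm m : ℝ) / |(z : ℝ)| = 1 / |(q : ℝ)| := by
    rw [hzabs]
    field_simp
  have hez (i : Fin m) : 1 / ((((i : ℕ) : ℝ) + 1) * (q : ℝ)) = e i / z := by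
    simp only [hzr, he]
    field_simp
  refine linearIndependent_rat_of_int fun g hg => ?_
  simp only [hez] at hg
  obtain ⟨n, hn⟩ := (frequently_dLcm_pow_mul_lt_one hm hk hd' (abs_pos.mpr hq0) hq
    (Finset.sum_nonneg fun x _ => abs_nonneg (g x : ℝ))).exists
  have hzero := eq_zero_of_sum_mul_padeVector_eq_zero (n := n) (z := z)
    (c := fun x => (g x : ℝ)) hinj (fun i => (he0 i).ne') fun l hl => ?_
  · intro x
    exact Int.cast_eq_zero.mp (congrFun hzero x)
  have hD : (0 : ℝ) < (dLcm (m * (k * (n + 1))) : ℝ) ^ k :=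
    pow_pos (by exact_mod_cast dLcm_pos _) k
  obtain ⟨a, ha⟩ : (dLcm (m * (k * (n + 1))) : ℝ) ^ k *
      ∑ x, (g x : ℝ) * padeVector k e z (padePoly k n e (Polynomial.X ^ l)) x ∈
      (Int.castRingHom ℝ).range := by
    rw [Finset.mul_sum]
    refine sum_mem fun x _ => ?_
    rw [mul_left_comm]
    exact mul_mem ⟨g x, rfl⟩ (dLcm_pow_mul_padeVector_mem_range h_range z hl x)
  have hlt : |(a : ℝ)| < 1 := by
    rw [← eq_intCast (Int.castRingHom ℝ), ha, abs_mul, abs_of_pos hD]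
    refine lt_of_le_of_lt (mul_le_mul_of_nonneg_left ?_ hD.le) hn
    refine (abs_sum_mul_padeVector_le (zero_le_one.trans hd')
      (fun i => (abs_of_pos (he0 i)).trans_le (hed i)) ?_ hz0 _ hg).trans ?_
    · rw [hzabs, mul_comm]
      gcongr
    · rw [hdz]
      gcongr
      exact polyWeight_padePoly_X_pow_le hd' (fun i => (he0 i).le) hed hl
  have ha0 : a = 0 := Int.abs_lt_one_iff.mp (by exact_mod_cast hlt)
  rw [ha0, map_zero] at ha
  exact (mul_eq_zero.mp ha.symm).resolve_left hD.ne'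
end
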